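/- Let T be a tree with n vertices and exactly r branching vertices, where 1 ≤ r ≤ n/2 − 1. Then ξ^{ce}(T) ≤ ξ^{ce}(B(n,r)). -/

import Mathlib

open Finset SimpleGraph

variable {V : Type*}

open Classical in
/-- The degree of a vertex `u` in a graph `G` (number of neighbors). -/
noncomputable def deg [Fintype V] (G : SimpleGraph V) (u : V) : ℕ :=
  (Finset.univ.filter (fun v => G.Adj u v)).card

/-- The eccentricity of a vertex `u`: the maximum distance from `u` to any vertex. -/
noncomputable def ecc [Fintype V] (G : SimpleGraph V) (u : V) : ℕ :=
  Finset.univ.sup (fun v => G.dist u v)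

/-- The connective eccentricity index `ξ^{ce}(G) = Σ_{u ∈ V} d(u)/ε(u)`. -/
noncomputable def cei [Fintype V] (G : SimpleGraph V) : ℝ :=
  ∑ u : V, (deg G u : ℝ) / (ecc G u)

/-- The number of branching vertices (vertices of degree at least 3) of `T`. -/
noncomputable def branchCount [Fintype V] (T : SimpleGraph V) : ℕ :=
  (Finset.univ.filter (fun v => 3 ≤ deg T v)).card

/-- `G` has degree sequence `d = (d₁, …, d_n)` (up to relabeling of the vertices). -/
def hasDegSeq [Fintype V] (G : SimpleGraph V) {n : ℕ} (d : Fin n → ℕ) : Prop :=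
  ∃ e : V ≃ Fin n, ∀ v, deg G v = d (e v)

/-- The rooted tree `(T, r)` has level-degree sequence `L`: for each `i`, `L i` is the
multiset of degrees of the vertices at height (distance from the root) `i`. -/
def hasLevelDegSeq [Fintype V] (T : SimpleGraph V) (r : V) (L : ℕ → Multiset ℕ) : Prop :=
  ∀ i : ℕ, L i = ((Finset.univ.filter (fun v => T.dist r v = i)).val.map (deg T))

/-- The rooted tree `(T, r)` is level-greedy: there is a left-to-right ordering `ord`
of the vertices of each level such that within every level the degrees are
non-increasing from left to right, and each vertex of a level joins its children to
the first so-far-unconnected vertices of the next level, i.e. the children of an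
earlier vertex come before the children of a later vertex. -/
def IsLevelGreedy [Fintype V] (T : SimpleGraph V) (r : V) : Prop :=
  ∃ ord : V → ℕ,
    (∀ u v, T.dist r u = T.dist r v → ord u = ord v → u = v) ∧
    (∀ u v, T.dist r u = T.dist r v → ord u ≤ ord v → deg T v ≤ deg T u) ∧
    (∀ p q u v, T.dist r u = T.dist r v →
      T.Adj p u → T.dist r u = T.dist r p + 1 →
      T.Adj q v → T.dist r v = T.dist r q + 1 →
      ord p < ord q → ord u < ord v)

/-- The rooted tree `(T, r)` is the greedy tree for its degree sequence: it is
level-greedy, the root has maximal degree, and every degree occurring at height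
`i + 1` is at most every degree occurring at height `i`. -/
def IsGreedyTree [Fintype V] (T : SimpleGraph V) (r : V) : Prop :=
  IsLevelGreedy T r ∧ (∀ v, deg T v ≤ deg T r) ∧
    (∀ u v : V, T.dist r u = T.dist r v + 1 → deg T u ≤ deg T v)

/-- The degree sequence of `B(n,r)`: one entry `n - 2r + 1`, then `r - 1` threes,
then `n - r` ones. -/
def dB (n r : ℕ) : Fin n → ℕ := fun i =>
  if (i : ℕ) = 0 then n - 2 * r + 1 else if (i : ℕ) < r then 3 else 1

section TreeMetric

variable {G : SimpleGraph V}

theorem exists_adj_dist_succ (hG : G.Connected) {c u : V} (h : G.dist c u ≠ 0) :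
    ∃ p, G.Adj p u ∧ G.dist c u = G.dist c p + 1 := by
  obtain ⟨w, hw⟩ := hG.exists_walk_length_eq_dist u c
  cases w with
  | nil => simp at h
  | @cons _ p _ hadj q =>
    refine ⟨p, hadj.symm, ?_⟩
    have h₁ := G.dist_le q
    have h₂ : G.dist c u ≤ G.dist c p + G.dist p u := hG.dist_triangle
    rw [dist_eq_one_iff_adj.2 hadj.symm] at h₂
    rw [Walk.length_cons] at hw
    rw [dist_comm (u := u)] at hw
    rw [dist_comm (u := p)] at h₁
    omega

theorem eq_of_adj_of_dist_succ (hG : G.IsTree) {c u p q : V}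
    (hp : G.Adj p u) (hdp : G.dist c u = G.dist c p + 1)
    (hq : G.Adj q u) (hdq : G.dist c u = G.dist c q + 1) : p = q := by
  obtain ⟨w, hw⟩ := hG.connected.exists_walk_length_eq_dist c p
  obtain ⟨w', hw'⟩ := hG.connected.exists_walk_length_eq_dist c q
  have h₁ : (w.concat hp).IsPath :=
    Walk.isPath_of_length_eq_dist _ (by rw [Walk.length_concat]; omega)
  have h₂ : (w'.concat hq).IsPath :=
    Walk.isPath_of_length_eq_dist _ (by rw [Walk.length_concat]; omega)
  have h := (hG.existsUnique_path c u).unique h₁ h₂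
  simpa using congrArg Walk.penultimate h

theorem dist_eq_succ_or_of_adj_adj (hG : G.IsTree) {a m b : V} (ha : G.Adj a m)
    (hb : G.Adj b m) (hab : a ≠ b) (u : V) :
    G.dist u a = G.dist u m + 1 ∨ G.dist u b = G.dist u m + 1 := by
  rcases hG.dist_eq_dist_add_one_of_adj u ha with h | h
  · exact Or.inl h
  rcases hG.dist_eq_dist_add_one_of_adj u hb with h' | h'
  · exact Or.inr h'
  exact absurd (eq_of_adj_of_dist_succ hG ha h hb h') hab

/-- Distances between the two sides of an edge `ab` of a tree are realised through the edge. -/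
theorem dist_eq_add_of_separated (hG : G.IsTree) {a b u : V} (hab : G.Adj a b)
    (hu : G.dist u b = G.dist u a + 1) (y : V) (hy : G.dist y a = G.dist y b + 1) :
    G.dist u y = G.dist u b + G.dist b y := by
  induction hk : G.dist b y using Nat.strong_induction_on generalizing y with
  | _ k ih =>
  have hyb : G.dist y b = G.dist b y := dist_comm
  rcases Nat.eq_zero_or_pos k with rfl | hpos
  · rw [hG.connected.dist_eq_zero_iff.1 hk]; rfl
  obtain ⟨p, hpy, hdp⟩ := exists_adj_dist_succ hG.connected (c := b) (u := y) (by omega)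
  have side : ∀ z p, G.Adj p z → G.dist z a = G.dist z b + 1 → G.dist b z = G.dist b p + 1 →
      G.dist p a = G.dist p b + 1 := by
    intro z p hpz hz hd
    have h₁ : G.dist z a ≤ G.dist z p + G.dist p a := hG.connected.dist_triangle
    rw [dist_eq_one_iff_adj.2 hpz.symm] at h₁
    have h₂ : G.dist p a ≤ G.dist p b + G.dist b a := hG.connected.dist_triangle
    rw [dist_eq_one_iff_adj.2 hab.symm] at h₂
    rw [dist_comm (u := z) (v := b)] at hz
    rw [dist_comm (u := p) (v := b)] at h₂ ⊢
    omega
  have hpa := side y p hpy hy hdp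
  have ihp := ih (G.dist b p) (by omega) p hpa rfl
  rcases hG.dist_eq_dist_add_one_of_adj u hpy with h | h
  · exfalso
    rcases Nat.eq_zero_or_pos (G.dist b p) with h0 | h0
    · obtain rfl := hG.connected.dist_eq_zero_iff.1 h0
      obtain rfl := eq_of_adj_of_dist_succ hG hpy.symm h hab hu
      simp at hy
    · obtain ⟨q, hqp, hdq⟩ := exists_adj_dist_succ hG.connected (c := b) (u := p) (by omega)
      have ihq := ih (G.dist b q) (by omega) q (side p q hqp hpa hdq) rfl
      obtain rfl := eq_of_adj_of_dist_succ hG hpy.symm h hqp (by omega)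
      omega
  · omega

theorem dist_eq_add_or_of_between (hG : G.IsTree) {x y c : V} (hx : G.dist x c ≠ 0)
    (hy : G.dist y c ≠ 0) (hxy : G.dist x y = G.dist x c + G.dist y c) (u : V) :
    G.dist u x = G.dist u c + G.dist x c ∨ G.dist u y = G.dist u c + G.dist y c := by
  obtain ⟨a, ha, hda⟩ := exists_adj_dist_succ hG.connected hx
  obtain ⟨b, hb, hdb⟩ := exists_adj_dist_succ hG.connected hy
  have hab : a ≠ b := by
    rintro rfl
    have h : G.dist x y ≤ G.dist x a + G.dist a y := hG.connected.dist_triangle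
    rw [dist_comm (u := a)] at h
    omega
  rcases dist_eq_succ_or_of_adj_adj hG ha hb hab u with h | h
  · left
    have := dist_eq_add_of_separated hG ha.symm h x hda
    rw [dist_comm (u := a)] at this
    omega
  · right
    have := dist_eq_add_of_separated hG hb.symm h y hdb
    rw [dist_comm (u := b)] at this
    omega

theorem exists_dist_eq_of_le (hG : G.Connected) {x y : V} {k : ℕ} (hk : k ≤ G.dist x y) :
    ∃ c, G.dist x c = k ∧ G.dist x y = G.dist x c + G.dist c y := by
  induction hd : G.dist x y - k generalizing k with
  | zero => exact ⟨y, by omega, by simp⟩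
  | succ d ih =>
    obtain ⟨c, hc, hcy⟩ := ih (k := k + 1) (by omega) (by omega)
    obtain ⟨p, hp, hdp⟩ := exists_adj_dist_succ hG (c := x) (u := c) (by omega)
    refine ⟨p, by omega, ?_⟩
    have h₁ : G.dist x y ≤ G.dist x p + G.dist p y := hG.dist_triangle
    have h₂ : G.dist p y ≤ G.dist p c + G.dist c y := hG.dist_triangle
    rw [dist_eq_one_iff_adj.2 hp] at h₂
    omega

/-- The distance from a vertex to a pair of (possibly equal) vertices. -/
noncomputable def pairLevel (G : SimpleGraph V) (c c' v : V) : ℕ :=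
  min (G.dist c v) (G.dist c' v)

/-- A finite tree has a central vertex or a central edge. -/
theorem exists_center [Fintype V] [Nontrivial V] (hG : G.IsTree) :
    (∃ c R, (∀ v, pairLevel G c c v ≤ R) ∧ ∀ u, R + pairLevel G c c u ≤ ecc G u) ∨
    ∃ c c' R, G.Adj c c' ∧ (∀ v, pairLevel G c c' v ≤ R) ∧
      ∀ u, R + 1 + pairLevel G c c' u ≤ ecc G u := by
  obtain ⟨⟨x, y⟩, -, hmax⟩ := Finset.exists_max_image (Finset.univ : Finset (V × V))
    (fun q => G.dist q.1 q.2) ⟨Classical.arbitrary _, Finset.mem_univ _⟩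
  replace hmax : ∀ u v, G.dist u v ≤ G.dist x y := fun u v => hmax (u, v) (Finset.mem_univ _)
  have hecc : ∀ u v, G.dist u v ≤ ecc G u := fun u v =>
    Finset.le_sup (f := fun v => G.dist u v) (Finset.mem_univ v)
  have hpos : 0 < G.dist x y := by
    obtain ⟨u, v, huv⟩ := exists_pair_ne V
    exact (hG.connected.pos_dist_of_ne huv).trans_le (hmax u v)
  rcases Nat.even_or_odd' (G.dist x y) with ⟨R, hR | hR⟩
  · obtain ⟨c, hc, hcy⟩ := exists_dist_eq_of_le hG.connected (x := x) (y := y) (k := R) (by omega)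
    rw [dist_comm (u := c)] at hcy
    have key := dist_eq_add_or_of_between hG (x := x) (y := y) (c := c)
      (by omega) (by omega) (by omega)
    refine Or.inl ⟨c, R, fun u => ?_, fun u => ?_⟩ <;>
    · rw [pairLevel, min_self, dist_comm]
      have := hecc u x
      have := hecc u y
      have := hmax u x
      have := hmax u y
      have := key u
      omega
  · obtain ⟨c, hc, hcy⟩ := exists_dist_eq_of_le hG.connected (x := x) (y := y) (k := R) (by omega)
    obtain ⟨c', hadj, hc'⟩ :=
      exists_adj_dist_succ hG.connected (c := y) (u := c) (by rw [dist_comm]; omega)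
    rw [dist_comm (u := c)] at hcy
    have hxc' : G.dist x c' = R + 1 := by
      have h₁ : G.dist x y ≤ G.dist x c' + G.dist c' y := hG.connected.dist_triangle
      rw [dist_comm (u := c')] at h₁
      have := hG.dist_eq_dist_add_one_of_adj x hadj
      omega
    refine Or.inr ⟨c, c', R, hadj.symm, fun u => ?_, fun u => ?_⟩ <;>
    · rw [pairLevel, dist_comm (u := c), dist_comm (u := c')]
      have := hecc u x
      have := hecc u y
      have := hmax u x
      have := hmax u y
      rcases hG.dist_eq_dist_add_one_of_adj u hadj with h | h
      · have := dist_eq_add_of_separated hG hadj.symm h y (by omega)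
        rw [dist_comm (u := c')] at this
        omega
      · have := dist_eq_add_of_separated hG hadj h x (by omega)
        rw [dist_comm (u := c)] at this
        omega

theorem ecc_le_of_pairLevel_le [Fintype V] (hG : G.Connected) {c c' : V} {e R : ℕ}
    (hcc : G.dist c c' ≤ e) (hR : ∀ v, pairLevel G c c' v ≤ R) (u : V) :
    ecc G u ≤ R + e + pairLevel G c c' u := by
  refine Finset.sup_le fun v _ => ?_
  have hv := hR v
  unfold pairLevel at *
  have h₁ : G.dist u v ≤ G.dist u c + G.dist c v := hG.dist_triangle
  have h₂ : G.dist u v ≤ G.dist u c' + G.dist c' v := hG.dist_triangle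
  have h₃ : G.dist u c ≤ G.dist u c' + G.dist c' c := hG.dist_triangle
  have h₄ : G.dist u c' ≤ G.dist u c + G.dist c c' := hG.dist_triangle
  rw [dist_comm (u := c') (v := c)] at h₃
  rw [dist_comm (u := u) (v := c)] at *
  rw [dist_comm (u := u) (v := c')] at *
  omega

end TreeMetric

section Counting

open Classical in
/-- In a tree, the closed neighbourhood of a subtree `A` has `2 + ∑ (deg - 1)` vertices. -/
theorem card_closedNeighborhood_add_card [Fintype V] {G : SimpleGraph V} (hG : G.IsTree) {c : V}
    {A N : Finset V} (hc : c ∈ A)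
    (hA : ∀ u ∈ A, ∀ p, G.Adj p u → G.dist c u = G.dist c p + 1 → p ∈ A)
    (hN : ∀ v, v ∈ N ↔ v ∈ A ∨ ∃ u ∈ A, G.Adj u v) :
    #N + #A = 2 + ∑ u ∈ A, deg G u := by
  have hdeg : ∀ u, deg G u =
      #{v | G.Adj u v ∧ G.dist c v = G.dist c u + 1} +
      #{v | G.Adj u v ∧ G.dist c u = G.dist c v + 1} := by
    intro u
    rw [deg, ← Finset.card_union_of_disjoint]
    · congr 1
      ext v
      simp only [mem_filter, mem_univ, true_and, mem_union, ← and_or_left]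
      exact ⟨fun h => ⟨h, (hG.dist_eq_dist_add_one_of_adj c h).symm⟩, And.left⟩
    · rw [Finset.disjoint_filter]
      rintro v - ⟨-, h⟩ ⟨-, h'⟩
      omega
  have hpos : ∀ {v}, v ≠ c → G.dist c v ≠ 0 := fun h => (hG.connected.pos_dist_of_ne h.symm).ne'
  have up : ∑ u ∈ A, #{v | G.Adj u v ∧ G.dist c u = G.dist c v + 1} = #(A.erase c) := by
    have h0 : #{v | G.Adj c v ∧ G.dist c c = G.dist c v + 1} = 0 := by simp
    rw [← Finset.add_sum_erase A _ hc, h0, zero_add, Finset.card_eq_sum_ones]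
    refine Finset.sum_congr rfl fun u hu => ?_
    obtain ⟨p, hp, hdp⟩ := exists_adj_dist_succ hG.connected (hpos (Finset.ne_of_mem_erase hu))
    rw [Finset.card_eq_one]
    refine ⟨p, ?_⟩
    ext v
    simp only [mem_filter, mem_univ, true_and, mem_singleton]
    constructor
    · rintro ⟨h₁, h₂⟩
      exact eq_of_adj_of_dist_succ hG h₁.symm h₂ hp hdp
    · rintro rfl
      exact ⟨hp.symm, hdp⟩
  have down : ∑ u ∈ A, #{v | G.Adj u v ∧ G.dist c v = G.dist c u + 1} = #(N.erase c) := by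
    rw [← Finset.card_biUnion]
    · congr 1
      ext v
      simp only [mem_biUnion, mem_filter, mem_univ, true_and, mem_erase]
      constructor
      · rintro ⟨u, hu, huv, hd⟩
        refine ⟨?_, (hN v).2 (Or.inr ⟨u, hu, huv⟩)⟩
        rintro rfl
        simp at hd
      · rintro ⟨hvc, hv⟩
        have inner : v ∈ A → ∃ u ∈ A, G.Adj u v ∧ G.dist c v = G.dist c u + 1 := by
          intro hvA
          obtain ⟨p, hp, hdp⟩ := exists_adj_dist_succ hG.connected (hpos hvc)
          exact ⟨p, hA v hvA p hp hdp, hp, hdp⟩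
        rcases (hN v).1 hv with h | ⟨u, hu, huv⟩
        · exact inner h
        · rcases hG.dist_eq_dist_add_one_of_adj c huv with h | h
          · exact inner (hA u hu v huv.symm h)
          · exact ⟨u, hu, huv, h⟩
    · intro u _ u' _ hne
      rw [Function.onFun, Finset.disjoint_filter]
      rintro v - ⟨h₁, h₂⟩ ⟨h₃, h₄⟩
      exact hne (eq_of_adj_of_dist_succ hG h₁ h₂ h₃ h₄)
  have hcN : c ∈ N := (hN c).2 (Or.inl hc)
  rw [Finset.sum_congr rfl fun u _ => hdeg u, Finset.sum_add_distrib, up, down,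
    Finset.card_erase_of_mem hc, Finset.card_erase_of_mem hcN]
  have := Finset.card_pos.2 ⟨c, hc⟩
  have := Finset.card_pos.2 ⟨c, hcN⟩
  omega

/-- The set of vertices within distance `k` of a pair of vertices. -/
noncomputable def pairBall [Fintype V] (G : SimpleGraph V) (c c' : V) (k : ℕ) : Finset V :=
  Finset.univ.filter fun v => pairLevel G c c' v ≤ k

theorem mem_pairBall [Fintype V] {G : SimpleGraph V} {c c' v : V} {k : ℕ} :
    v ∈ pairBall G c c' k ↔ G.dist c v ≤ k ∨ G.dist c' v ≤ k := by
  simp [pairBall, pairLevel]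

theorem card_pairBall_succ_add [Fintype V] {G : SimpleGraph V} (hG : G.IsTree) {c c' : V}
    (hcc : G.dist c c' ≤ 1) (k : ℕ) :
    #(pairBall G c c' (k + 1)) + #(pairBall G c c' k) =
      2 + ∑ u ∈ pairBall G c c' k, deg G u := by
  refine card_closedNeighborhood_add_card hG (c := c) (mem_pairBall.2 (by simp)) ?_ ?_
  · intro u hu p _ hd
    rw [mem_pairBall] at hu ⊢
    have h : G.dist c u ≤ G.dist c c' + G.dist c' u := hG.connected.dist_triangle
    omega
  · intro v
    constructor
    · intro hv
      have extend : ∀ x, (∀ u, G.dist x u ≤ k → u ∈ pairBall G c c' k) →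
          G.dist x v ≤ k + 1 →
          v ∈ pairBall G c c' k ∨ ∃ u ∈ pairBall G c c' k, G.Adj u v := by
        intro x hx hxv
        by_cases h : G.dist x v ≤ k
        · exact Or.inl (hx v h)
        · obtain ⟨p, hp, hd⟩ := exists_adj_dist_succ hG.connected (c := x) (u := v) (by omega)
          exact Or.inr ⟨p, hx p (by omega), hp⟩
      rcases mem_pairBall.1 hv with h | h
      · exact extend c (fun u hu => mem_pairBall.2 (Or.inl hu)) h
      · exact extend c' (fun u hu => mem_pairBall.2 (Or.inr hu)) h
    · rintro (h | ⟨u, hu, huv⟩)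
      · rw [mem_pairBall] at h ⊢
        omega
      · rw [mem_pairBall] at hu ⊢
        have h₁ : G.dist c v ≤ G.dist c u + G.dist u v := hG.connected.dist_triangle
        have h₂ : G.dist c' v ≤ G.dist c' u + G.dist u v := hG.connected.dist_triangle
        rw [dist_eq_one_iff_adj.2 huv] at h₁ h₂
        omega

theorem card_pairBall_zero_self [Fintype V] {G : SimpleGraph V} (hG : G.Connected) (c : V) :
    #(pairBall G c c 0) = 1 := by
  rw [Finset.card_eq_one]
  refine ⟨c, ?_⟩
  ext v
  rw [mem_pairBall]
  simp [hG.dist_eq_zero_iff, eq_comm]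

theorem card_pairBall_zero_of_adj [Fintype V] {G : SimpleGraph V} (hG : G.Connected) {c c' : V}
    (h : G.Adj c c') : #(pairBall G c c' 0) = 2 := by
  classical
  rw [Finset.card_eq_two]
  refine ⟨c, c', h.ne, ?_⟩
  ext v
  rw [mem_pairBall]
  simp [hG.dist_eq_zero_iff, eq_comm]

theorem pairBall_eq_univ [Fintype V] {G : SimpleGraph V} {c c' : V} {k : ℕ} :
    #(pairBall G c c' k) = Fintype.card V ↔ ∀ v, pairLevel G c c' v ≤ k := by
  rw [Finset.card_eq_iff_eq_univ, Finset.eq_univ_iff_forall]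
  simp [pairBall]

theorem sum_deg_add_two [Fintype V] {G : SimpleGraph V} (hG : G.IsTree) :
    ∑ u, deg G u + 2 = 2 * Fintype.card V := by
  obtain ⟨c⟩ := hG.connected.nonempty
  have := card_closedNeighborhood_add_card hG (Finset.mem_univ c) (N := Finset.univ)
    (fun _ _ _ _ _ => Finset.mem_univ _) (by simp)
  rw [Finset.card_univ] at this
  omega

theorem one_le_deg [Fintype V] [Nontrivial V] {G : SimpleGraph V} (hG : G.Connected) (u : V) :
    1 ≤ deg G u := by
  obtain ⟨v, hv⟩ := exists_ne u
  obtain ⟨p, hp, -⟩ := exists_adj_dist_succ hG (hG.pos_dist_of_ne hv).ne'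
  exact Finset.card_pos.2 ⟨p, by simpa using hp.symm⟩

/-- The largest possible size of the closed neighbourhood of a subtree with `j` vertices in a tree
with `n` vertices, `r` of them branching. -/
def maxNext (n r j : ℕ) : ℕ := n - 2 * (r - j)

theorem maxNext_mono (n r : ℕ) : Monotone (maxNext n r) := by
  intro i j hij
  unfold maxNext
  omega

theorem maxNext_iterate_le {n r j : ℕ} (hj : j ≤ n) (k : ℕ) : (maxNext n r)^[k] j ≤ n := by
  cases k with
  | zero => exact hj
  | succ k =>
    rw [Function.iterate_succ_apply']
    exact Nat.sub_le _ _

theorem card_branching_split [Fintype V] [DecidableEq V] (G : SimpleGraph V) (A : Finset V) :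
    #{v ∈ A | 3 ≤ deg G v} + #{v ∈ Aᶜ | 3 ≤ deg G v} = branchCount G := by
  rw [branchCount, ← Finset.card_union_of_disjoint, ← Finset.filter_union, Finset.union_compl]
  exact Finset.disjoint_filter_filter disjoint_compl_right

theorem card_pairBall_succ_le [Fintype V] [Nontrivial V] {G : SimpleGraph V} (hG : G.IsTree)
    {c c' : V} (hcc : G.dist c c' ≤ 1) (k : ℕ) :
    #(pairBall G c c' (k + 1)) ≤
      maxNext (Fintype.card V) (branchCount G) #(pairBall G c c' k) := by
  classical
  have hsucc := card_pairBall_succ_add hG hcc k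
  set A := pairBall G c c' k
  have htot := sum_deg_add_two hG
  rw [← Finset.sum_add_sum_compl A] at htot
  have hcompl : #Aᶜ + 2 * #{v ∈ Aᶜ | 3 ≤ deg G v} ≤ ∑ v ∈ Aᶜ, deg G v := by
    rw [Finset.card_filter, Finset.card_eq_sum_ones, Finset.mul_sum, ← Finset.sum_add_distrib]
    refine Finset.sum_le_sum fun v _ => ?_
    have := one_le_deg hG.connected v
    split_ifs <;> omega
  have hsplit := card_branching_split G A
  have hA : #{v ∈ A | 3 ≤ deg G v} ≤ #A := Finset.card_filter_le _ _
  have hcard := Finset.card_add_card_compl A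
  unfold maxNext
  omega

theorem card_pairBall_succ_eq [Fintype V] {G : SimpleGraph V} (hG : G.IsTree)
    {c c' : V} (hcc : G.dist c c' ≤ 1) (k : ℕ)
    (hdeg : ∀ v ∉ pairBall G c c' k, deg G v = 1 ∨ deg G v = 3)
    (hfill : ∀ u ∈ pairBall G c c' k, ∀ v ∉ pairBall G c c' k, 3 ≤ deg G v → 3 ≤ deg G u) :
    #(pairBall G c c' (k + 1)) =
      maxNext (Fintype.card V) (branchCount G) #(pairBall G c c' k) := by
  classical
  have hsucc := card_pairBall_succ_add hG hcc k
  set A := pairBall G c c' k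
  have htot := sum_deg_add_two hG
  rw [← Finset.sum_add_sum_compl A] at htot
  have hcompl : #Aᶜ + 2 * #{v ∈ Aᶜ | 3 ≤ deg G v} = ∑ v ∈ Aᶜ, deg G v := by
    rw [Finset.card_filter, Finset.card_eq_sum_ones, Finset.mul_sum, ← Finset.sum_add_distrib]
    refine Finset.sum_congr rfl fun v hv => ?_
    have := hdeg v (Finset.mem_compl.1 hv)
    split_ifs <;> omega
  have hsplit := card_branching_split G A
  have hA : #{v ∈ A | 3 ≤ deg G v} ≤ #A := Finset.card_filter_le _ _
  have hcard := Finset.card_add_card_compl A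
  have hdich : #{v ∈ Aᶜ | 3 ≤ deg G v} = 0 ∨ #{v ∈ A | 3 ≤ deg G v} = #A := by
    rw [or_iff_not_imp_left]
    intro h
    obtain ⟨v, hv⟩ := Finset.card_pos.1 (Nat.pos_of_ne_zero h)
    rw [Finset.mem_filter, Finset.mem_compl] at hv
    rw [Finset.filter_true_of_mem fun u hu => hfill u hu v hv.1 hv.2]
  unfold maxNext
  omega

theorem card_pairBall_le_iterate [Fintype V] [Nontrivial V] {G : SimpleGraph V} (hG : G.IsTree)
    {c c' : V} (hcc : G.dist c c' ≤ 1) (k : ℕ) :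
    #(pairBall G c c' k) ≤
      (maxNext (Fintype.card V) (branchCount G))^[k] #(pairBall G c c' 0) := by
  induction k with
  | zero => rfl
  | succ k ih =>
    rw [Function.iterate_succ_apply']
    exact (card_pairBall_succ_le hG hcc k).trans (maxNext_mono _ _ ih)

end Counting

section Summation

theorem eq_add_sum_range_ite (w : ℕ → ℝ) {j K : ℕ} (hj : j ≤ K) :
    w j = w K + ∑ k ∈ Finset.range K, if j ≤ k then w k - w (k + 1) else 0 := by
  rw [← Finset.sum_filter]
  have h : {k ∈ Finset.range K | j ≤ k} = Finset.Ico j K := by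
    ext k
    simp [and_comm]
  have hsum := Finset.sum_Ico_sub w hj
  rw [← neg_inj, ← Finset.sum_neg_distrib] at hsum
  simp only [neg_sub] at hsum
  rw [h, hsum]
  ring

theorem sum_mul_comp_eq {U : Type*} [Fintype U] (f l : U → ℕ) (w : ℕ → ℝ) {K : ℕ}
    (hl : ∀ v, l v ≤ K) :
    ∑ v, (f v : ℝ) * w (l v) = w K * ((∑ v with l v ≤ K, f v : ℕ) : ℝ) +
      ∑ k ∈ Finset.range K, (w k - w (k + 1)) * ((∑ v with l v ≤ k, f v : ℕ) : ℝ) := by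
  rw [Finset.filter_true_of_mem fun v _ => hl v]
  simp only [Nat.cast_sum, Finset.mul_sum, Finset.sum_filter]
  rw [Finset.sum_comm, ← Finset.sum_add_distrib]
  refine Finset.sum_congr rfl fun v _ => ?_
  rw [eq_add_sum_range_ite w (hl v), mul_add, Finset.mul_sum, mul_comm]
  congr 1
  refine Finset.sum_congr rfl fun k _ => ?_
  split_ifs
  · ring
  · simp

/-- Moving weight to lower levels increases a sum with antitone coefficients. -/
theorem sum_mul_antitone_le {W : Type*} [Fintype V] [Fintype W] (f l : V → ℕ) (g m : W → ℕ)
    {w : ℕ → ℝ} (hw : Antitone w) (hw0 : ∀ k, 0 ≤ w k)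
    (hcum : ∀ k, ∑ v with l v ≤ k, f v ≤ ∑ v with m v ≤ k, g v) :
    ∑ v, (f v : ℝ) * w (l v) ≤ ∑ v, (g v : ℝ) * w (m v) := by
  have hl : ∀ v, l v ≤ Finset.univ.sup l + Finset.univ.sup m := fun v =>
    (Finset.le_sup (f := l) (Finset.mem_univ v)).trans (Nat.le_add_right _ _)
  have hm : ∀ v, m v ≤ Finset.univ.sup l + Finset.univ.sup m := fun v =>
    (Finset.le_sup (f := m) (Finset.mem_univ v)).trans (Nat.le_add_left _ _)
  rw [sum_mul_comp_eq f l w hl, sum_mul_comp_eq g m w hm]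
  refine add_le_add (mul_le_mul_of_nonneg_left (Nat.cast_le.2 (hcum _)) (hw0 _))
    (Finset.sum_le_sum fun k _ => mul_le_mul_of_nonneg_left (Nat.cast_le.2 (hcum k)) ?_)
  exact sub_nonneg.2 (hw k.le_succ)

theorem one_le_ecc [Fintype V] [Nontrivial V] {G : SimpleGraph V} (hG : G.Connected) (u : V) :
    1 ≤ ecc G u := by
  obtain ⟨v, hv⟩ := exists_ne u
  exact (Nat.succ_le_of_lt (hG.pos_dist_of_ne hv.symm)).trans
    (Finset.le_sup (f := fun v => G.dist u v) (Finset.mem_univ v))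

theorem cei_le_of_levels {W : Type*} [Fintype V] [Fintype W] [Nontrivial W]
    {T : SimpleGraph V} {B : SimpleGraph W} (hB : B.Connected) {h : ℕ} (hh : 1 ≤ h)
    (l : V → ℕ) (m : W → ℕ) (hl : ∀ u, h + l u ≤ ecc T u) (hm : ∀ u, ecc B u ≤ h + m u)
    (hcum : ∀ k, ∑ v with l v ≤ k, deg T v ≤ ∑ v with m v ≤ k, deg B v) :
    cei T ≤ cei B := by
  have hpos : (0 : ℝ) < h := by exact_mod_cast hh
  have hw : Antitone fun k : ℕ => (1 : ℝ) / (h + k) := by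
    intro i j hij
    have : (i : ℝ) ≤ j := by exact_mod_cast hij
    exact one_div_le_one_div_of_le (by positivity) (by linarith)
  calc cei T ≤ ∑ u, (deg T u : ℝ) * (1 / (h + (l u : ℕ))) := by
        refine Finset.sum_le_sum fun u _ => ?_
        rw [div_eq_mul_one_div]
        have : (h : ℝ) + l u ≤ ecc T u := by exact_mod_cast hl u
        gcongr
    _ ≤ ∑ u, (deg B u : ℝ) * (1 / (h + (m u : ℕ))) :=
        sum_mul_antitone_le (deg T) l (deg B) m hw (fun k => by positivity) hcum
    _ ≤ cei B := by
        refine Finset.sum_le_sum fun u _ => ?_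
        rw [div_eq_mul_one_div (deg B u : ℝ) (ecc B u : ℝ)]
        have : (ecc B u : ℝ) ≤ h + m u := by exact_mod_cast hm u
        have : (0 : ℝ) < ecc B u := by exact_mod_cast one_le_ecc hB u
        gcongr

end Summation

section Greedy

theorem deg_le_of_dist_lt [Fintype V] {G : SimpleGraph V} (hG : G.Connected) {c : V}
    (h : ∀ u v : V, G.dist c u = G.dist c v + 1 → deg G u ≤ deg G v) {u v : V}
    (huv : G.dist c u < G.dist c v) : deg G v ≤ deg G u := by
  induction hd : G.dist c v - G.dist c u generalizing v with
  | zero => omega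
  | succ d ih =>
    obtain ⟨p, -, hp⟩ := exists_adj_dist_succ hG (c := c) (u := v) (by omega)
    rcases Nat.lt_or_ge (G.dist c u) (G.dist c p) with hlt | hge
    · exact (h v p hp).trans (ih hlt (by omega))
    · exact h v u (by omega)

theorem card_pairBall_eq_iterate_self [Fintype V] {G : SimpleGraph V} (hG : G.IsTree) {c : V}
    (hdeg : ∀ v, v ≠ c → deg G v = 1 ∨ deg G v = 3)
    (hlev : ∀ u v : V, G.dist c u = G.dist c v + 1 → deg G u ≤ deg G v) (k : ℕ) :
    #(pairBall G c c k) = (maxNext (Fintype.card V) (branchCount G))^[k] 1 := by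
  induction k with
  | zero => exact card_pairBall_zero_self hG.connected c
  | succ k ih =>
    rw [Function.iterate_succ_apply', ← ih]
    refine card_pairBall_succ_eq hG (by simp) k ?_ ?_
    · intro v hv
      refine hdeg v ?_
      rintro rfl
      exact hv (mem_pairBall.2 (by simp))
    · intro u hu v hv h3
      rw [mem_pairBall] at hu hv
      exact h3.trans (deg_le_of_dist_lt hG.connected hlev (by omega))

/-- In a level-greedy tree the branch of the leftmost child precedes all other branches. -/
theorem ord_lt_of_first_branch {G : SimpleGraph V} (hG : G.Connected) {c a : V} {ord : V → ℕ}
    (hac : G.Adj c a)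
    (hfirst : ∀ v, G.dist c v = 1 → v ≠ a → ord a < ord v)
    (hord : ∀ p q u v, G.dist c u = G.dist c v →
      G.Adj p u → G.dist c u = G.dist c p + 1 →
      G.Adj q v → G.dist c v = G.dist c q + 1 → ord p < ord q → ord u < ord v)
    {j : ℕ} {u v : V} (hu : G.dist c u = j + 1) (hv : G.dist c v = j + 1)
    (hau : G.dist a u = j) (hav : j < G.dist a v) : ord u < ord v := by
  induction j generalizing u v with
  | zero =>
    obtain rfl := hG.dist_eq_zero_iff.1 hau
    refine hfirst v hv ?_
    rintro rfl
    simp at hav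
  | succ j ih =>
    obtain ⟨p, hpu, hp⟩ := exists_adj_dist_succ hG (c := a) (u := u) (by omega)
    obtain ⟨q, hqv, hq⟩ := exists_adj_dist_succ hG (c := c) (u := v) (by omega)
    have h₁ : G.dist c p ≤ G.dist c a + G.dist a p := hG.dist_triangle
    have h₂ : G.dist c u ≤ G.dist c p + G.dist p u := hG.dist_triangle
    have h₃ : G.dist a v ≤ G.dist a q + G.dist q v := hG.dist_triangle
    rw [dist_eq_one_iff_adj.2 hac] at h₁
    rw [dist_eq_one_iff_adj.2 hpu] at h₂
    rw [dist_eq_one_iff_adj.2 hqv] at h₃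
    exact hord p q u v (by omega) hpu (by omega) hqv hq
      (ih (by omega) (by omega) (by omega) (by omega))

theorem exists_adj_card_pairBall_eq_iterate [Fintype V] [Nontrivial V] {G : SimpleGraph V}
    (hG : G.IsTree) {c : V} (hdeg : ∀ v, v ≠ c → deg G v = 1 ∨ deg G v = 3)
    (hgreedy : IsGreedyTree G c) :
    ∃ a, G.Adj c a ∧ ∀ k,
      #(pairBall G c a k) = (maxNext (Fintype.card V) (branchCount G))^[k] 2 := by
  classical
  obtain ⟨⟨ord, hinj, hmono, hord⟩, -, hlev⟩ := hgreedy
  have hne : (Finset.univ.filter fun v => G.Adj c v).Nonempty :=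
    Finset.card_pos.1 (one_le_deg hG.connected c)
  obtain ⟨a, ha, hmin⟩ := Finset.exists_min_image _ ord hne
  have hca : G.Adj c a := by simpa using ha
  have hda : G.dist c a = 1 := dist_eq_one_iff_adj.2 hca
  have hfirst : ∀ v, G.dist c v = 1 → v ≠ a → ord a < ord v := by
    intro v hv hva
    refine lt_of_le_of_ne (hmin v (by simpa using dist_eq_one_iff_adj.1 hv)) fun h => ?_
    exact hva (hinj a v (hda.trans hv.symm) h).symm
  refine ⟨a, hca, fun k => ?_⟩
  induction k with
  | zero => exact card_pairBall_zero_of_adj hG.connected hca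
  | succ k ih =>
    rw [Function.iterate_succ_apply', ← ih]
    refine card_pairBall_succ_eq hG hda.le k ?_ ?_
    · intro v hv
      refine hdeg v ?_
      rintro rfl
      exact hv (mem_pairBall.2 (by simp))
    · intro u hu v hv h3
      rw [mem_pairBall] at hu hv
      by_cases huv : G.dist c u < G.dist c v
      · exact h3.trans (deg_le_of_dist_lt hG.connected hlev huv)
      · have h₁ : G.dist c u ≤ G.dist c a + G.dist a u := hG.connected.dist_triangle
        have hlt := ord_lt_of_first_branch hG.connected hca hfirst hord (j := k) (u := u) (v := v)
          (by omega) (by omega) (by omega) (by omega)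
        exact h3.trans (hmono u v (by omega) hlt.le)

theorem branchCount_of_hasDegSeq_dB {n r : ℕ} (hr : 1 ≤ r) (hrn : 2 * r + 2 ≤ n) [Fintype V]
    {G : SimpleGraph V} (hG : hasDegSeq G (dB n r)) : branchCount G = r := by
  obtain ⟨e, he⟩ := hG
  have h : (Finset.univ.filter fun v => 3 ≤ deg G v).map e.toEmbedding =
      Finset.univ.filter fun i : Fin n => (i : ℕ) < r := by
    ext i
    simp only [Finset.mem_map_equiv, Finset.mem_filter, Finset.mem_univ, true_and, he,
      Equiv.apply_symm_apply, dB]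
    split_ifs <;> omega
  rw [branchCount, ← Finset.card_map e.toEmbedding, h, Fin.card_filter_val_lt]
  omega

theorem deg_eq_one_or_three_of_hasDegSeq_dB {n r : ℕ} (hrn : 2 * r + 2 ≤ n) [Fintype V]
    {G : SimpleGraph V} (hG : hasDegSeq G (dB n r)) {c : V} (hc : ∀ v, deg G v ≤ deg G c) {v : V}
    (hv : v ≠ c) : deg G v = 1 ∨ deg G v = 3 := by
  obtain ⟨e, he⟩ := hG
  have hne : (e v : ℕ) ≠ e c := fun h => hv (e.injective (Fin.ext h))
  have hle := hc v
  rw [he v, he c] at hle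
  rw [he v]
  unfold dB at *
  split_ifs at * <;> omega

end Greedy

/-- if `T` is a tree on `n` vertices with exactly `r` branching
vertices, `1 ≤ r ≤ n/2 - 1`, and `B = B(n,r)` is the greedy tree with degree
sequence `(n-2r+1, 3,…,3, 1,…,1)`, then `ξ^{ce}(T) ≤ ξ^{ce}(B(n,r))`. -/
theorem cei_le_B_of_branchCount {n r : ℕ} (hr : 1 ≤ r) (hrn : 2 * r + 2 ≤ n)
    [Fintype V] (hcard : Fintype.card V = n)
    (T : SimpleGraph V) (hT : T.IsTree) (hbr : branchCount T = r)
    {W : Type*} [Fintype W] (B : SimpleGraph W) (rt : W) (hB : B.IsTree)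
    (hdB : hasDegSeq B (dB n r)) (hg : IsGreedyTree B rt) :
    cei T ≤ cei B := by
  have hcardW : Fintype.card W = n := by
    obtain ⟨e, -⟩ := hdB
    rw [Fintype.card_congr e, Fintype.card_fin]
  have : Nontrivial V := Fintype.one_lt_card_iff_nontrivial.1 (by omega)
  have : Nontrivial W := Fintype.one_lt_card_iff_nontrivial.1 (by omega)
  have hbrB := branchCount_of_hasDegSeq_dB hr hrn hdB
  have hdegB : ∀ v, v ≠ rt → deg B v = 1 ∨ deg B v = 3 := fun v =>
    deg_eq_one_or_three_of_hasDegSeq_dB hrn hdB hg.2.1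
  have hrtcard := card_pairBall_eq_iterate_self hB hdegB hg.2.2
  obtain ⟨a, hrta, hedgecard⟩ := exists_adj_card_pairBall_eq_iterate hB hdegB hg
  rw [hbrB, hcardW] at hrtcard hedgecard
  have hTle := fun (c c' : V) hcc k => card_pairBall_le_iterate hT (c := c) (c' := c') hcc k
  rw [hbr, hcard] at hTle
  have hTsum := fun (c c' : V) hcc k => card_pairBall_succ_add hT (c := c) (c' := c') hcc k
  have hBsum := fun (c c' : W) hcc k => card_pairBall_succ_add hB (c := c) (c' := c') hcc k
  have hshift : ∀ k, (maxNext n r)^[k] 2 ≤ (maxNext n r)^[k + 1] 1 := fun k => by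
    rw [Function.iterate_succ_apply]
    exact (maxNext_mono n r).iterate k (by unfold maxNext; omega)
  have hle_one := maxNext_iterate_le (n := n) (r := r) (j := 1) (by omega)
  have hle_two := maxNext_iterate_le (n := n) (r := r) (j := 2) (by omega)
  have hex : ∃ k, (maxNext n r)^[k] 1 = n := by
    refine ⟨Finset.univ.sup (pairLevel B rt rt), ?_⟩
    rw [← hrtcard, ← hcardW, pairBall_eq_univ]
    exact fun v => Finset.le_sup (Finset.mem_univ v)
  obtain ⟨h, hspec, hmin⟩ : ∃ h, (maxNext n r)^[h] 1 = n ∧ ∀ k, n ≤ (maxNext n r)^[k] 1 → h ≤ k :=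
    ⟨Nat.find hex, Nat.find_spec hex, fun k hk => Nat.find_min' hex ((hle_one k).antisymm hk)⟩
  have hh : 1 ≤ h := by
    rcases Nat.eq_zero_or_pos h with rfl | hpos
    · rw [Function.iterate_zero, id_eq] at hspec
      omega
    · exact hpos
  have hlevB : ∀ v, pairLevel B rt rt v ≤ h := by
    rw [← pairBall_eq_univ, hrtcard, hspec, hcardW]
  have heccB : ∀ u, ecc B u ≤ h + pairLevel B rt rt u :=
    ecc_le_of_pairLevel_le hB.connected (e := 0) (by simp) hlevB
  rcases exists_center hT with ⟨c, R, hlev, hecc⟩ | ⟨c, c', R, hadj, hlev, hecc⟩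
  · have hcc : T.dist c c ≤ 1 := by simp
    have hTcard := hTle c c hcc
    rw [card_pairBall_zero_self hT.connected] at hTcard
    have hhR : h ≤ R := hmin R <| by
      rw [← pairBall_eq_univ, hcard] at hlev
      exact hlev.ge.trans (hTcard R)
    refine cei_le_of_levels hB.connected hh (pairLevel T c c) (pairLevel B rt rt)
      (fun u => (Nat.add_le_add_right hhR _).trans (hecc u)) heccB fun k => ?_
    change ∑ v ∈ pairBall T c c k, deg T v ≤ ∑ v ∈ pairBall B rt rt k, deg B v
    have h₁ := hTsum c c hcc k
    have h₂ := hBsum rt rt (by simp) k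
    rw [hrtcard, hrtcard] at h₂
    have h₃ := hTcard k
    have h₄ := hTcard (k + 1)
    omega
  · have hcc : T.dist c c' ≤ 1 := (dist_eq_one_iff_adj.2 hadj).le
    have hTcard := hTle c c' hcc
    rw [card_pairBall_zero_of_adj hT.connected hadj] at hTcard
    have hnR : n ≤ (maxNext n r)^[R] 2 := by
      rw [← pairBall_eq_univ, hcard] at hlev
      exact hlev.ge.trans (hTcard R)
    have hhR : h ≤ R + 1 := hmin (R + 1) (hnR.trans (hshift R))
    by_cases hbi : (maxNext n r)^[h - 1] 2 = n
    · have hrtd : B.dist rt a ≤ 1 := (dist_eq_one_iff_adj.2 hrta).le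
      have hlevB' : ∀ v, pairLevel B rt a v ≤ h - 1 := by
        rw [← pairBall_eq_univ, hedgecard, hbi, hcardW]
      refine cei_le_of_levels hB.connected hh (pairLevel T c c') (pairLevel B rt a)
        (fun u => (Nat.add_le_add_right hhR _).trans (hecc u)) (fun u => ?_) fun k => ?_
      · have := ecc_le_of_pairLevel_le hB.connected hrtd hlevB' u
        omega
      · change ∑ v ∈ pairBall T c c' k, deg T v ≤ ∑ v ∈ pairBall B rt a k, deg B v
        have h₁ := hTsum c c' hcc k
        have h₂ := hBsum rt a hrtd k
        rw [hedgecard, hedgecard] at h₂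
        have h₃ := hTcard k
        have h₄ := hTcard (k + 1)
        omega
    · have hlt : h ≤ R := by
        by_contra hcon
        obtain rfl : R = h - 1 := by omega
        exact hbi ((hle_two _).antisymm hnR)
      refine cei_le_of_levels hB.connected hh (fun v => pairLevel T c c' v + 1)
        (pairLevel B rt rt) (fun u => ?_) heccB fun k => ?_
      · have := hecc u
        omega
      · cases k with
        | zero => simp
        | succ k =>
          simp only [Nat.add_le_add_iff_right]
          change ∑ v ∈ pairBall T c c' k, deg T v ≤ ∑ v ∈ pairBall B rt rt (k + 1), deg B v
          have h₁ := hTsum c c' hcc k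
          have h₂ := hBsum rt rt (by simp) (k + 1)
          rw [hrtcard, hrtcard] at h₂
          have h₃ := (hTcard k).trans (hshift k)
          have h₄ := (hTcard (k + 1)).trans (hshift (k + 1))
          omega
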